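/- arXiv:math/0608492 — 5 statements merged into one kernel-verified Lean document; each statement's English description precedes it below -/
import Mathlib

section
/- Let X₁, X₂ be polynomials in two complex variables with X₁(x₁⁰, x₂⁰) ≠ 0, and let f be a function of one complex variable analytic at x₂⁰. Then there exists a function ω(x₁,x₂), analytic in a neighborhood of (x₁⁰,x₂⁰), satisfying X₁·∂₁ω + X₂·∂₂ω = 0 in a neighborhood of (x₁⁰,x₂⁰) and ω(x₁⁰, x₂) = f(x₂) for all x₂ in a neighborhood of x₂⁰; moreover ω is unique as a germ at (x₁⁰,x₂⁰): any two analytic functions with these properties agree on a neighborhood of (x₁⁰,x₂⁰). -/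
open Filter MvPolynomial

/-- Evaluation of a polynomial in two variables at a point of `ℂ × ℂ`. -/
noncomputable def pev (P : MvPolynomial (Fin 2) ℂ) (p : ℂ × ℂ) : ℂ :=
  MvPolynomial.eval ![p.1, p.2] P

/-- Partial derivative with respect to the first variable. -/
noncomputable def d1 : (ℂ × ℂ → ℂ) → (ℂ × ℂ → ℂ) :=
  fun f p => deriv (fun x => f (x, p.2)) p.1

/-- Partial derivative with respect to the second variable. -/
noncomputable def d2 : (ℂ × ℂ → ℂ) → (ℂ × ℂ → ℂ) :=
  fun f p => deriv (fun y => f (p.1, y)) p.2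

/-- The differential operator `X(g) = X₁·∂₁g + X₂·∂₂g`. -/
noncomputable def Xop (X₁ X₂ : MvPolynomial (Fin 2) ℂ) (f : ℂ × ℂ → ℂ) : ℂ × ℂ → ℂ :=
  fun p => pev X₁ p * d1 f p + pev X₂ p * d2 f p

/-- A first integral of `X` at `p`: a nonconstant function, analytic near `p`,
annihilated by `X` near `p`. -/
def IsFirstIntegralAt (X₁ X₂ : MvPolynomial (Fin 2) ℂ) (ω : ℂ × ℂ → ℂ) (p : ℂ × ℂ) : Prop :=
  AnalyticAt ℂ ω p ∧ (∀ᶠ q in nhds p, Xop X₁ X₂ ω q = 0) ∧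
    ¬ ∃ c : ℂ, ∀ᶠ q in nhds p, ω q = c

/-- The functions `Bᵢ = −X₁·∂₂^{i+1}(X₂/X₁)`. -/
noncomputable def B (X₁ X₂ : MvPolynomial (Fin 2) ℂ) (i : ℕ) : ℂ × ℂ → ℂ :=
  fun p => -(pev X₁ p) * (d2^[i + 1] (fun q => pev X₂ q / pev X₁ q)) p

open scoped unitInterval Topology

/-- A function satisfying the integral form of `h' = g` along segments from `0` satisfies the
differential form. -/
lemma hasDerivAt_of_eq_segment_integral {g h : ℂ → ℂ} {c : ℂ} {ε : ℝ}
    (hg : DifferentiableOn ℂ g (Metric.ball 0 ε))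
    (hh : ∀ t ∈ Metric.ball (0 : ℂ) ε, h t = c + t * ∫ r in (0 : ℝ)..1, g (r * t))
    {t : ℂ} (ht : t ∈ Metric.ball (0 : ℂ) ε) : HasDerivAt h (g t) t := by
  obtain ⟨G, hG⟩ := hg.isExactOn_ball
  have key : ∀ s ∈ Metric.ball (0 : ℂ) ε, h s = c + (G s - G 0) := by
    intro s hs
    rw [hh s hs, ← intervalIntegral.integral_const_mul]
    have hmem : ∀ r ∈ Set.uIcc (0 : ℝ) 1, (r : ℂ) * s ∈ Metric.ball (0 : ℂ) ε := by
      intro r hr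
      rw [Set.uIcc_of_le zero_le_one] at hr
      rw [mem_ball_zero_iff] at hs ⊢
      rw [norm_mul, Complex.norm_real, Real.norm_of_nonneg hr.1]
      exact (mul_le_of_le_one_left (norm_nonneg _) hr.2).trans_lt hs
    have hderiv : ∀ r ∈ Set.uIcc (0 : ℝ) 1,
        HasDerivAt (fun r : ℝ => G (r * s)) (s * g (r * s)) r := by
      intro r hr
      have h1 : HasDerivAt (fun z : ℂ => z * s) s (r : ℂ) := by
        simpa using (hasDerivAt_id (r : ℂ)).mul_const s
      have h2 := ((hG _ (hmem r hr)).comp (r : ℂ) h1).comp_ofReal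
      simpa [mul_comm] using h2
    have hcont : ContinuousOn (fun r : ℝ => s * g (r * s)) (Set.uIcc (0 : ℝ) 1) := by
      refine continuousOn_const.mul (hg.continuousOn.comp ?_ hmem)
      fun_prop
    rw [intervalIntegral.integral_eq_sub_of_hasDerivAt hderiv hcont.intervalIntegrable]
    simp
  refine HasDerivAt.congr_of_eventuallyEq (f := fun s => c + (G s - G 0)) ?_ ?_
  · exact ((hG t ht).sub_const _).const_add _
  · filter_upwards [Metric.isOpen_ball.mem_nhds ht] with s hs using key s hs

/-- Integration from `0`, as a bounded operator on continuous functions on `[0, 1]`. -/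
noncomputable def primitiveCLM : C(I, ℂ) →L[ℂ] C(I, ℂ) :=
  LinearMap.mkContinuous
    { toFun := fun g =>
        ⟨fun s => ∫ r in (0 : ℝ)..s, g (Set.projIcc 0 1 zero_le_one r), by
          have : Continuous fun r : ℝ => g (Set.projIcc 0 1 zero_le_one r) :=
            g.continuous.comp continuous_projIcc
          exact (intervalIntegral.continuous_primitive
            (fun a b => this.intervalIntegrable a b) 0).comp continuous_subtype_val⟩
      map_add' := fun g h => by
        ext s
        simp only [ContinuousMap.add_apply, ContinuousMap.coe_mk]
        exact intervalIntegral.integral_add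
          ((g.continuous.comp continuous_projIcc).intervalIntegrable _ _)
          ((h.continuous.comp continuous_projIcc).intervalIntegrable _ _)
      map_smul' := fun a g => by
        ext s
        simp } 1 (fun g => by
      rw [ContinuousMap.norm_le _ (by positivity)]
      intro s
      refine (intervalIntegral.norm_integral_le_of_norm_le_const
        (fun r _ => g.norm_coe_le_norm _)).trans ?_
      rw [sub_zero, abs_of_nonneg s.2.1, one_mul]
      exact mul_le_of_le_one_right (norm_nonneg _) s.2.2)

lemma primitiveCLM_apply (g : C(I, ℂ)) (s : I) :
    primitiveCLM g s = ∫ r in (0 : ℝ)..s, g (Set.projIcc 0 1 zero_le_one r) := rfl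

/-- The contraction `s ↦ l * s` of the unit interval. -/
noncomputable def scaleMap (l : I) : C(I, I) := ⟨fun s => l * s, by fun_prop⟩

lemma mul_primitiveCLM_comp_scaleMap (g : C(I, ℂ)) (l s : I) :
    ((l : ℝ) : ℂ) * primitiveCLM (g.comp (scaleMap l)) s = primitiveCLM g (l * s) := by
  rw [primitiveCLM_apply, primitiveCLM_apply]
  have h := intervalIntegral.smul_integral_comp_mul_left (a := 0) (b := (s : ℝ))
    (fun r : ℝ => g (Set.projIcc 0 1 zero_le_one r)) (l : ℝ)
  rw [mul_zero] at h
  rw [Set.Icc.coe_mul, ← h, Complex.real_smul]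
  congr 1
  refine intervalIntegral.integral_congr fun r hr => ?_
  rw [Set.uIcc_of_le s.2.1] at hr
  have hr' : r ∈ I := ⟨hr.1, hr.2.trans s.2.2⟩
  have hl : (l : ℝ) * r ∈ I := unitInterval.mul_mem l.2 hr'
  simp only [ContinuousMap.comp_apply]
  rw [Set.projIcc_of_mem _ hr', Set.projIcc_of_mem _ hl]
  rfl

/-- Evaluation of a polynomial in two variables at a pair of continuous functions. -/
noncomputable def pevMap (P : MvPolynomial (Fin 2) ℂ) (u : C(I, ℂ) × C(I, ℂ)) : C(I, ℂ) :=
  MvPolynomial.aeval ![u.1, u.2] P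

lemma pevMap_apply (P : MvPolynomial (Fin 2) ℂ) (u : C(I, ℂ) × C(I, ℂ)) (s : I) :
    pevMap P u s = pev P (u.1 s, u.2 s) := by
  unfold pevMap pev
  induction P using MvPolynomial.induction_on with
  | C a => simp
  | add p q hp hq => simp [hp, hq]
  | mul_X p i hp => fin_cases i <;> simp [hp]

lemma pevMap_comp (P : MvPolynomial (Fin 2) ℂ) (u : C(I, ℂ) × C(I, ℂ)) (k : C(I, I)) :
    pevMap P (u.1.comp k, u.2.comp k) = (pevMap P u).comp k := by
  ext s
  simp [pevMap_apply]

lemma analyticAt_pevMap (P : MvPolynomial (Fin 2) ℂ) (u : C(I, ℂ) × C(I, ℂ)) :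
    AnalyticAt ℂ (pevMap P) u := by
  refine AnalyticAt.aeval_mvPolynomial (f := fun u : C(I, ℂ) × C(I, ℂ) => ![u.1, u.2])
    (fun i => ?_) P
  fin_cases i
  · exact analyticAt_fst
  · exact analyticAt_snd

lemma analyticAt_pev (P : MvPolynomial (Fin 2) ℂ) (q : ℂ × ℂ) : AnalyticAt ℂ (pev P) q := by
  have := AnalyticAt.aeval_mvPolynomial (𝕜 := ℂ) (f := fun u : ℂ × ℂ => ![u.1, u.2]) (z := q)
    (fun i => by
      fin_cases i
      · exact analyticAt_fst
      · exact analyticAt_snd) P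
  exact this

/-- The defect of `u` as a solution, in the time variable `s ∈ [0, 1]` rescaled by `p.1`, of the
flow equation with vector field `(X₁, X₂)` and initial value `(c, p.2)`. -/
noncomputable def flowDefect (X₁ X₂ : MvPolynomial (Fin 2) ℂ) (c : ℂ)
    (v : (ℂ × ℂ) × (C(I, ℂ) × C(I, ℂ))) : C(I, ℂ) × C(I, ℂ) :=
  (v.2.1 - algebraMap ℂ C(I, ℂ) c - v.1.1 • primitiveCLM (pevMap X₁ v.2),
    v.2.2 - algebraMap ℂ C(I, ℂ) v.1.2 - v.1.1 • primitiveCLM (pevMap X₂ v.2))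

lemma analyticAt_flowDefect (X₁ X₂ : MvPolynomial (Fin 2) ℂ) (c : ℂ)
    (v : (ℂ × ℂ) × (C(I, ℂ) × C(I, ℂ))) : AnalyticAt ℂ (flowDefect X₁ X₂ c) v := by
  have hJ : ∀ P, AnalyticAt ℂ
      (fun v : (ℂ × ℂ) × (C(I, ℂ) × C(I, ℂ)) => v.1.1 • primitiveCLM (pevMap P v.2)) v := by
    intro P
    have h1 : AnalyticAt ℂ (fun v : (ℂ × ℂ) × (C(I, ℂ) × C(I, ℂ)) => pevMap P v.2) v :=
      (analyticAt_pevMap P v.2).fun_comp analyticAt_snd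
    have h2 := (primitiveCLM.analyticAt _).fun_comp h1
    have h3 : AnalyticAt ℂ (fun v : (ℂ × ℂ) × (C(I, ℂ) × C(I, ℂ)) => v.1.1) v :=
      analyticAt_fst.fun_comp analyticAt_fst
    exact h3.smul h2
  have hη : AnalyticAt ℂ
      (fun v : (ℂ × ℂ) × (C(I, ℂ) × C(I, ℂ)) => algebraMap ℂ C(I, ℂ) v.1.2) v :=
    ((algebraMapCLM ℂ C(I, ℂ)).analyticAt _).fun_comp (analyticAt_snd.fun_comp analyticAt_fst)
  exact (((analyticAt_fst.fun_comp analyticAt_snd).sub analyticAt_const).sub (hJ X₁)).prod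
    (((analyticAt_snd.fun_comp analyticAt_snd).sub hη).sub (hJ X₂))

lemma flowDefect_zero_time (X₁ X₂ : MvPolynomial (Fin 2) ℂ) (c η : ℂ)
    (u : C(I, ℂ) × C(I, ℂ)) :
    flowDefect X₁ X₂ c ((0, η), u) = u - (algebraMap ℂ C(I, ℂ) c, algebraMap ℂ C(I, ℂ) η) := by
  refine Prod.ext (ContinuousMap.ext fun s => ?_) (ContinuousMap.ext fun s => ?_)
  · change u.1 s - c - 0 * primitiveCLM (pevMap X₁ u) s = u.1 s - c
    rw [zero_mul, sub_zero]
  · change u.2 s - η - 0 * primitiveCLM (pevMap X₂ u) s = u.2 s - η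
    rw [zero_mul, sub_zero]

lemma fderiv_flowDefect_comp_inr (X₁ X₂ : MvPolynomial (Fin 2) ℂ) (c η : ℂ)
    (u : C(I, ℂ) × C(I, ℂ)) :
    fderiv ℂ (flowDefect X₁ X₂ c) ((0, η), u) ∘L .inr ℂ (ℂ × ℂ) (C(I, ℂ) × C(I, ℂ)) =
      ContinuousLinearMap.id ℂ _ := by
  have h1 : HasFDerivAt (fun u : C(I, ℂ) × C(I, ℂ) => flowDefect X₁ X₂ c ((0, η), u))
      (fderiv ℂ (flowDefect X₁ X₂ c) ((0, η), u) ∘L .inr ℂ (ℂ × ℂ) (C(I, ℂ) × C(I, ℂ))) u :=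
    (analyticAt_flowDefect X₁ X₂ c ((0, η), u)).differentiableAt.hasFDerivAt.comp u
      (hasFDerivAt_prodMk_right _ _)
  have h2 : HasFDerivAt (fun u : C(I, ℂ) × C(I, ℂ) => flowDefect X₁ X₂ c ((0, η), u))
      (ContinuousLinearMap.id ℂ _) u := by
    simp only [flowDefect_zero_time]
    exact (hasFDerivAt_id u).sub_const _
  exact h1.unique h2

lemma flowDefect_scale {X₁ X₂ : MvPolynomial (Fin 2) ℂ} {c t η : ℂ} {u : C(I, ℂ) × C(I, ℂ)}
    (h : flowDefect X₁ X₂ c ((t, η), u) = 0) (l : I) :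
    flowDefect X₁ X₂ c
      ((((l : ℝ) : ℂ) * t, η), (u.1.comp (scaleMap l), u.2.comp (scaleMap l))) = 0 := by
  have h1 := congrArg Prod.fst h
  have h2 := congrArg Prod.snd h
  simp only [flowDefect, Prod.fst_zero, Prod.snd_zero] at h1 h2
  refine Prod.ext ?_ ?_
  · ext s
    have := DFunLike.congr_fun h1 (l * s)
    simp only [flowDefect, pevMap_comp]
    simp only [ContinuousMap.sub_apply, ContinuousMap.smul_apply, smul_eq_mul,
      ← mul_primitiveCLM_comp_scaleMap] at this
    simp only [ContinuousMap.sub_apply, ContinuousMap.smul_apply, smul_eq_mul]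
    rw [mul_comm (l : ℂ) t, mul_assoc]
    exact this
  · ext s
    have := DFunLike.congr_fun h2 (l * s)
    simp only [flowDefect, pevMap_comp]
    simp only [ContinuousMap.sub_apply, ContinuousMap.smul_apply, smul_eq_mul,
      ← mul_primitiveCLM_comp_scaleMap] at this
    simp only [ContinuousMap.sub_apply, ContinuousMap.smul_apply, smul_eq_mul]
    rw [mul_comm (l : ℂ) t, mul_assoc]
    exact this

open scoped ContDiff in
/-- Local existence of the complex analytic flow of the polynomial vector field `(X₁, X₂)`, started
on the line `x₁ = x0.1`. -/
lemma exists_analytic_flow (X₁ X₂ : MvPolynomial (Fin 2) ℂ) (x0 : ℂ × ℂ) :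
    ∃ Φ : ℂ × ℂ → ℂ × ℂ, AnalyticAt ℂ Φ (0, x0.2) ∧
      (∀ᶠ η in 𝓝 x0.2, Φ (0, η) = (x0.1, η)) ∧
      ∀ᶠ p in 𝓝 ((0 : ℂ), x0.2),
        HasDerivAt (fun t => Φ (t, p.2)) (pev X₁ (Φ p), pev X₂ (Φ p)) p.1 := by
  set F := flowDefect X₁ X₂ x0.1 with hF
  set p₀ : ℂ × ℂ := (0, x0.2) with hp₀
  set u₀ : C(I, ℂ) × C(I, ℂ) := (algebraMap ℂ _ x0.1, algebraMap ℂ _ x0.2) with hu₀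
  have cdf : ContDiffAt ℂ ω F (p₀, u₀) := (analyticAt_flowDefect X₁ X₂ x0.1 _).contDiffAt
  have hω : (ω : ℕ∞ω) ≠ 0 := by simp
  have if₂ : (fderiv ℂ F (p₀, u₀) ∘L .inr ℂ (ℂ × ℂ) (C(I, ℂ) × C(I, ℂ))).IsInvertible := by
    rw [hF, hp₀, fderiv_flowDefect_comp_inr]
    exact ⟨ContinuousLinearEquiv.refl ℂ _, rfl⟩
  set U := cdf.implicitFunction hω if₂
  have hU₀ : U p₀ = u₀ := cdf.implicitFunction_apply_self hω if₂
  have hUan : AnalyticAt ℂ U p₀ :=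
    (cdf.contDiffAt_implicitFunction hω if₂).analyticAt
  have hF₀ : F (p₀, u₀) = 0 := by
    rw [hF, hp₀, flowDefect_zero_time, sub_self]
  have hsol := cdf.eventually_apply_implicitFunction hω if₂
  have huniq := cdf.eventually_apply_eq_iff_implicitFunction hω if₂
  rw [hF₀] at hsol huniq
  obtain ⟨δ, hδ, huniq⟩ := Metric.eventually_nhds_iff_ball.1 huniq
  have hnear : ∀ᶠ p in 𝓝 p₀, U p ∈ Metric.ball u₀ δ := by
    have := hUan.continuousAt
    rw [ContinuousAt, hU₀] at this
    exact this (Metric.ball_mem_nhds _ hδ)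
  let ev : C(I, ℂ) →L[ℂ] ℂ := ContinuousMap.evalCLM ℂ (1 : I)
  let Φ : ℂ × ℂ → ℂ × ℂ := fun p => ((U p).1 1, (U p).2 1)
  have hΦ : ∀ p, AnalyticAt ℂ U p → AnalyticAt ℂ Φ p := fun p hp =>
    ((ev.analyticAt _).fun_comp (analyticAt_fst.fun_comp hp)).prod
      ((ev.analyticAt _).fun_comp (analyticAt_snd.fun_comp hp))
  obtain ⟨ε', hε', hball⟩ := Metric.eventually_nhds_iff_ball.1
    (hsol.and (hnear.and hUan.eventually_analyticAt))
  obtain ⟨ε, hε, hεε', hεδ⟩ : ∃ ε > 0, ε ≤ ε' ∧ ε ≤ δ :=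
    ⟨min ε' δ, lt_min hε' hδ, min_le_left _ _, min_le_right _ _⟩
  have hmem : ∀ t ∈ Metric.ball (0 : ℂ) ε, ∀ η ∈ Metric.ball x0.2 ε,
      (t, η) ∈ Metric.ball p₀ ε := by
    intro t ht η hη
    rw [hp₀, ← ball_prod_same]
    exact ⟨ht, hη⟩
  have hscale : ∀ t ∈ Metric.ball (0 : ℂ) ε, ∀ η ∈ Metric.ball x0.2 ε, ∀ l : I,
      Φ (((l : ℝ) : ℂ) * t, η) = ((U (t, η)).1 l, (U (t, η)).2 l) := by
    intro t ht η hη l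
    obtain ⟨h1, h2, -⟩ := hball _ (Metric.ball_subset_ball hεε' (hmem t ht η hη))
    have hl : ((l : ℝ) : ℂ) * t ∈ Metric.ball (0 : ℂ) ε := by
      rw [mem_ball_zero_iff] at ht ⊢
      rw [norm_mul, Complex.norm_real, Real.norm_of_nonneg l.2.1]
      exact (mul_le_of_le_one_left (norm_nonneg _) l.2.2).trans_lt ht
    have h3 : ((U (t, η)).1.comp (scaleMap l), (U (t, η)).2.comp (scaleMap l)) ∈
        Metric.ball u₀ δ := by
      rw [← Prod.mk.eta (p := u₀), ← ball_prod_same] at h2 ⊢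
      have key : ∀ (g : C(I, ℂ)) (a : ℂ), g ∈ Metric.ball (algebraMap ℂ C(I, ℂ) a) δ →
          g.comp (scaleMap l) ∈ Metric.ball (algebraMap ℂ C(I, ℂ) a) δ := by
        intro g a hg
        rw [Metric.mem_ball] at hg ⊢
        refine lt_of_le_of_lt ((ContinuousMap.dist_le dist_nonneg).2 fun s => ?_) hg
        exact ContinuousMap.dist_apply_le_dist (f := g) (g := algebraMap ℂ C(I, ℂ) a)
          (scaleMap l s)
      exact ⟨key _ _ h2.1, key _ _ h2.2⟩
    have h4 := (huniq ((((l : ℝ) : ℂ) * t, η),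
      ((U (t, η)).1.comp (scaleMap l), (U (t, η)).2.comp (scaleMap l))) (by
        rw [← ball_prod_same]
        exact ⟨Metric.ball_subset_ball hεδ (hmem _ hl η hη), h3⟩)).1 (flowDefect_scale h1 l)
    change U (((l : ℝ) : ℂ) * t, η) = _ at h4
    simp only [Φ, h4, ContinuousMap.comp_apply]
    have : scaleMap l 1 = l := mul_one l
    rw [this]
  have hint : ∀ (P : MvPolynomial (Fin 2) ℂ), ∀ t ∈ Metric.ball (0 : ℂ) ε,
      ∀ η ∈ Metric.ball x0.2 ε, primitiveCLM (pevMap P (U (t, η))) 1 =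
        ∫ r in (0 : ℝ)..1, pev P (Φ (r * t, η)) := by
    intro P t ht η hη
    rw [primitiveCLM_apply]
    refine intervalIntegral.integral_congr fun r hr => ?_
    change r ∈ Set.uIcc (0 : ℝ) 1 at hr
    rw [Set.uIcc_of_le zero_le_one] at hr
    simp only [Set.projIcc_of_mem _ hr, pevMap_apply]
    rw [← hscale t ht η hη ⟨r, hr⟩]
  have hdiff : ∀ (P : MvPolynomial (Fin 2) ℂ), ∀ η ∈ Metric.ball x0.2 ε,
      DifferentiableOn ℂ (fun t => pev P (Φ (t, η))) (Metric.ball 0 ε) := by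
    intro P η hη t ht
    have h1 := hΦ _ (hball _ (Metric.ball_subset_ball hεε' (hmem t ht η hη))).2.2
    have h2 : AnalyticAt ℂ (fun t : ℂ => (t, η)) t := analyticAt_id.prod analyticAt_const
    exact ((analyticAt_pev P _).fun_comp
      (AnalyticAt.fun_comp (f := fun t : ℂ => (t, η)) h1 h2)).differentiableAt.differentiableWithinAt
  refine ⟨Φ, hΦ _ hUan, ?_, ?_⟩
  · filter_upwards [Metric.ball_mem_nhds x0.2 hε] with η hη
    obtain ⟨h1, -⟩ := hball _ (Metric.ball_subset_ball hεε'
      (hmem 0 (Metric.mem_ball_self hε) η hη))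
    change F ((0, η), U (0, η)) = 0 at h1
    rw [hF, flowDefect_zero_time, sub_eq_zero] at h1
    simp only [Φ, h1]
    rfl
  · filter_upwards [Metric.ball_mem_nhds p₀ hε] with p hp
    rw [hp₀, ← ball_prod_same] at hp
    obtain ⟨ht, hη⟩ := hp
    have hval : ∀ t ∈ Metric.ball (0 : ℂ) ε,
        (Φ (t, p.2)).1 = x0.1 + t * ∫ r in (0 : ℝ)..1, pev X₁ (Φ (r * t, p.2)) ∧
        (Φ (t, p.2)).2 = p.2 + t * ∫ r in (0 : ℝ)..1, pev X₂ (Φ (r * t, p.2)) := by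
      intro t ht
      obtain ⟨h1, -⟩ := hball _ (Metric.ball_subset_ball hεε' (hmem t ht p.2 hη))
      rw [← hint X₁ t ht p.2 hη, ← hint X₂ t ht p.2 hη]
      have e1 : (Φ (t, p.2)).1 - x0.1 - t * primitiveCLM (pevMap X₁ (U (t, p.2))) 1 = 0 :=
        DFunLike.congr_fun (congrArg Prod.fst h1) 1
      have e2 : (Φ (t, p.2)).2 - p.2 - t * primitiveCLM (pevMap X₂ (U (t, p.2))) 1 = 0 :=
        DFunLike.congr_fun (congrArg Prod.snd h1) 1
      exact ⟨by linear_combination e1, by linear_combination e2⟩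
    exact (hasDerivAt_of_eq_segment_integral (hdiff X₁ p.2 hη) (fun t ht => (hval t ht).1) ht).prodMk
      (hasDerivAt_of_eq_segment_integral (hdiff X₂ p.2 hη) (fun t ht => (hval t ht).2) ht)

/-- Along a curve tangent to the vector field, an analytic function varies according to `Xop`. -/
lemma hasDerivAt_comp_integral_curve {X₁ X₂ : MvPolynomial (Fin 2) ℂ} {w : ℂ × ℂ → ℂ}
    {γ : ℂ → ℂ × ℂ} {t : ℂ} (hw : DifferentiableAt ℂ w (γ t))
    (hγ : HasDerivAt γ (pev X₁ (γ t), pev X₂ (γ t)) t) :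
    HasDerivAt (fun s => w (γ s)) (Xop X₁ X₂ w (γ t)) t := by
  set L := fderiv ℂ w (γ t)
  have h1 : d1 w (γ t) = L (1, 0) := by
    have : HasDerivAt (fun x : ℂ => (x, (γ t).2)) ((1 : ℂ), (0 : ℂ)) (γ t).1 :=
      (hasDerivAt_id _).prodMk (hasDerivAt_const _ _)
    exact (HasFDerivAt.comp_hasDerivAt (γ t).1 (l := w) (f := fun x : ℂ => (x, (γ t).2))
      hw.hasFDerivAt this).deriv
  have h2 : d2 w (γ t) = L (0, 1) := by
    have : HasDerivAt (fun y : ℂ => ((γ t).1, y)) ((0 : ℂ), (1 : ℂ)) (γ t).2 :=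
      (hasDerivAt_const _ _).prodMk (hasDerivAt_id _)
    exact (HasFDerivAt.comp_hasDerivAt (γ t).2 (l := w) (f := fun y : ℂ => ((γ t).1, y))
      hw.hasFDerivAt this).deriv
  have h3 := HasFDerivAt.comp_hasDerivAt t hw.hasFDerivAt hγ
  have h4 : ((pev X₁ (γ t), pev X₂ (γ t)) : ℂ × ℂ) =
      pev X₁ (γ t) • (1, 0) + pev X₂ (γ t) • (0, 1) := by simp
  convert! h3 using 1
  rw [h4, map_add, map_smul, map_smul, Xop, h1, h2, smul_eq_mul, smul_eq_mul]

/-- Where `X₁ ≠ 0`, the flow started on the transversal `x₁ = x0.1` gives analytic coordinates. -/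
lemma exists_analytic_flow_chart {X₁ X₂ : MvPolynomial (Fin 2) ℂ} {x0 : ℂ × ℂ}
    (hX₁ : pev X₁ x0 ≠ 0) {Φ : ℂ × ℂ → ℂ × ℂ} (hΦ : AnalyticAt ℂ Φ (0, x0.2))
    (hΦ₀ : ∀ᶠ η in 𝓝 x0.2, Φ (0, η) = (x0.1, η))
    (hΦ' : ∀ᶠ p in 𝓝 ((0 : ℂ), x0.2),
      HasDerivAt (fun t => Φ (t, p.2)) (pev X₁ (Φ p), pev X₂ (Φ p)) p.1) :
    ∃ Ψ : ℂ × ℂ → ℂ × ℂ, AnalyticAt ℂ Ψ x0 ∧ Ψ x0 = (0, x0.2) ∧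
      (∀ᶠ p in 𝓝 ((0 : ℂ), x0.2), Ψ (Φ p) = p) ∧ ∀ᶠ q in 𝓝 x0, Φ (Ψ q) = q := by
  have hval : Φ (0, x0.2) = x0 := hΦ₀.self_of_nhds
  set L := fderiv ℂ Φ (0, x0.2)
  have hd : HasFDerivAt Φ L (0, x0.2) := hΦ.differentiableAt.hasFDerivAt
  have h1 : L (1, 0) = (pev X₁ x0, pev X₂ x0) := by
    have e := hΦ'.self_of_nhds
    simp only [hval] at e
    exact (HasFDerivAt.comp_hasDerivAt (0 : ℂ) (l := Φ) (f := fun t : ℂ => (t, x0.2)) hd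
      ((hasDerivAt_id _).prodMk (hasDerivAt_const _ _))).unique e
  have h2 : L (0, 1) = (0, 1) := by
    have e : HasDerivAt (fun η => Φ (0, η)) (0, 1) x0.2 :=
      ((hasDerivAt_const x0.2 x0.1).prodMk (hasDerivAt_id _)).congr_of_eventuallyEq hΦ₀
    exact (HasFDerivAt.comp_hasDerivAt x0.2 (l := Φ) (f := fun η : ℂ => ((0 : ℂ), η)) hd
      ((hasDerivAt_const _ _).prodMk (hasDerivAt_id _))).unique e
  have hLab : ∀ v : ℂ × ℂ, L v = (v.1 * pev X₁ x0, v.1 * pev X₂ x0 + v.2) := by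
    intro v
    have : v = v.1 • ((1 : ℂ), (0 : ℂ)) + v.2 • ((0 : ℂ), (1 : ℂ)) := by simp
    conv_lhs => rw [this, map_add, map_smul, map_smul, h1, h2]
    simp
  have hinj : Function.Injective (L : ℂ × ℂ →ₗ[ℂ] ℂ × ℂ) := by
    rw [injective_iff_map_eq_zero]
    intro v hv
    have e : L v = 0 := hv
    rw [hLab, Prod.mk_eq_zero] at e
    have e1 : v.1 = 0 := (mul_eq_zero.1 e.1).resolve_right hX₁
    have e2 : v.2 = 0 := by simpa [e1] using e.2
    exact Prod.ext e1 e2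
  let i : (ℂ × ℂ) ≃L[ℂ] (ℂ × ℂ) :=
    (LinearEquiv.ofInjectiveEndo _ hinj).toContinuousLinearEquiv
  have hi : (i : ℂ × ℂ →L[ℂ] ℂ × ℂ) = L := by
    ext <;> rfl
  have hs : HasStrictFDerivAt Φ (i : ℂ × ℂ →L[ℂ] ℂ × ℂ) (0, x0.2) := by
    rw [hi]
    exact hΦ.hasStrictFDerivAt
  have hsrc := hs.mem_toOpenPartialHomeomorph_source
  refine ⟨hs.localInverse Φ i _, ?_, ?_, hs.eventually_left_inverse, ?_⟩
  · have := (hs.toOpenPartialHomeomorph Φ).analyticAt_symm' (i := i) hsrc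
      (by simpa using hΦ) (by simpa using hi.symm)
    rw [hs.toOpenPartialHomeomorph_coe, hval] at this
    exact this
  · have := hs.localInverse_apply_image
    rwa [hval] at this
  · have := hs.eventually_right_inverse
    rwa [hval] at this

/-- A function which is annihilated by `X` and restricts to `f` on the transversal is, in the flow
coordinates, the function `f` of the second coordinate. -/
lemma eventually_comp_flow_eq {X₁ X₂ : MvPolynomial (Fin 2) ℂ} {x0 : ℂ × ℂ}
    {Φ : ℂ × ℂ → ℂ × ℂ} (hΦ : AnalyticAt ℂ Φ (0, x0.2))
    (hΦ₀ : ∀ᶠ η in 𝓝 x0.2, Φ (0, η) = (x0.1, η))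
    (hΦ' : ∀ᶠ p in 𝓝 ((0 : ℂ), x0.2),
      HasDerivAt (fun t => Φ (t, p.2)) (pev X₁ (Φ p), pev X₂ (Φ p)) p.1)
    {f : ℂ → ℂ} {w : ℂ × ℂ → ℂ} (hw : AnalyticAt ℂ w x0)
    (hXw : ∀ᶠ q in 𝓝 x0, Xop X₁ X₂ w q = 0) (hwf : ∀ᶠ y in 𝓝 x0.2, w (x0.1, y) = f y) :
    ∀ᶠ p in 𝓝 ((0 : ℂ), x0.2), w (Φ p) = f p.2 := by
  have hcont : Tendsto Φ (𝓝 (0, x0.2)) (𝓝 x0) := by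
    have := hΦ.continuousAt
    rwa [ContinuousAt, hΦ₀.self_of_nhds] at this
  obtain ⟨ε, hε, hball⟩ := Metric.eventually_nhds_iff_ball.1
    (hΦ'.and (hcont.eventually (hw.eventually_analyticAt.and hXw)))
  obtain ⟨ε', hε', hball'⟩ := Metric.eventually_nhds_iff_ball.1 (hΦ₀.and hwf)
  have hm : 0 < min ε ε' := lt_min hε hε'
  filter_upwards [Metric.ball_mem_nhds _ hm] with p hp
  rw [← ball_prod_same] at hp
  obtain ⟨ht, hη⟩ := hp
  have hderiv : ∀ t ∈ Metric.ball (0 : ℂ) (min ε ε'),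
      HasDerivAt (fun s => w (Φ (s, p.2))) 0 t := by
    intro t ht
    have hmem : (t, p.2) ∈ Metric.ball ((0 : ℂ), x0.2) ε := by
      rw [← ball_prod_same]
      exact ⟨Metric.ball_subset_ball (min_le_left _ _) ht,
        Metric.ball_subset_ball (min_le_left _ _) hη⟩
    obtain ⟨h1, h2, h3⟩ := hball _ hmem
    have := hasDerivAt_comp_integral_curve (γ := fun s => Φ (s, p.2)) h2.differentiableAt h1
    rwa [h3] at this
  have heq := Metric.isOpen_ball.is_const_of_deriv_eq_zero (convex_ball _ _).isPreconnected
    (fun t ht => (hderiv t ht).differentiableAt.differentiableWithinAt)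
    (fun t ht => (hderiv t ht).deriv) ht (Metric.mem_ball_self hm)
  obtain ⟨h1, h2⟩ := hball' p.2 (Metric.ball_subset_ball (min_le_right _ _) hη)
  exact heq.trans (by rw [h1, h2])

/-- existence and uniqueness (as a germ) of an analytic first integral with
prescribed restriction `ω(x₁⁰, ·) = f` near a point where `X₁ ≠ 0`. -/
theorem stmt_0 (X₁ X₂ : MvPolynomial (Fin 2) ℂ) (x0 : ℂ × ℂ)
    (hX₁ : pev X₁ x0 ≠ 0) (f : ℂ → ℂ) (hf : AnalyticAt ℂ f x0.2) :
    (∃ ω : ℂ × ℂ → ℂ, AnalyticAt ℂ ω x0 ∧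
        (∀ᶠ q in nhds x0, Xop X₁ X₂ ω q = 0) ∧
        (∀ᶠ y in nhds x0.2, ω (x0.1, y) = f y)) ∧
    (∀ ω₁ ω₂ : ℂ × ℂ → ℂ,
        AnalyticAt ℂ ω₁ x0 → (∀ᶠ q in nhds x0, Xop X₁ X₂ ω₁ q = 0) →
        (∀ᶠ y in nhds x0.2, ω₁ (x0.1, y) = f y) →
        AnalyticAt ℂ ω₂ x0 → (∀ᶠ q in nhds x0, Xop X₁ X₂ ω₂ q = 0) →
        (∀ᶠ y in nhds x0.2, ω₂ (x0.1, y) = f y) →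
        ∀ᶠ q in nhds x0, ω₁ q = ω₂ q) := by
  obtain ⟨Φ, hΦ, hΦ₀, hΦ'⟩ := exists_analytic_flow X₁ X₂ x0
  obtain ⟨Ψ, hΨ, hΨ₀, hΨΦ, hΦΨ⟩ := exists_analytic_flow_chart hX₁ hΦ hΦ₀ hΦ'
  have hcont : Tendsto Ψ (𝓝 x0) (𝓝 (0, x0.2)) := by
    have := hΨ.continuousAt
    rwa [ContinuousAt, hΨ₀] at this
  have hcontΦ : Tendsto Φ (𝓝 (0, x0.2)) (𝓝 x0) := by
    have := hΦ.continuousAt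
    rwa [ContinuousAt, hΦ₀.self_of_nhds] at this
  constructor
  · have hω : AnalyticAt ℂ (fun q => f (Ψ q).2) x0 :=
      AnalyticAt.fun_comp (by rwa [hΨ₀]) (analyticAt_snd.fun_comp hΨ)
    refine ⟨fun q => f (Ψ q).2, hω, ?_, ?_⟩
    · have key : ∀ᶠ p in 𝓝 ((0 : ℂ), x0.2), Xop X₁ X₂ (fun q => f (Ψ q).2) (Φ p) = 0 := by
        filter_upwards [hΨΦ.eventually_nhds, hΦ',
          hcontΦ.eventually hω.eventually_analyticAt] with p hp hp' hpω
        have h1 := hasDerivAt_comp_integral_curve (γ := fun s => Φ (s, p.2))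
          hpω.differentiableAt hp'
        have hline : Tendsto (fun s : ℂ => (s, p.2)) (𝓝 p.1) (𝓝 p) :=
          (Continuous.prodMk_left p.2).tendsto p.1
        have h2 : HasDerivAt (fun s => f (Ψ (Φ (s, p.2))).2) 0 p.1 := by
          refine (hasDerivAt_const p.1 (f p.2)).congr_of_eventuallyEq ?_
          filter_upwards [hline.eventually hp] with s hs
          rw [hs]
        exact h1.unique h2
      filter_upwards [hcont.eventually key, hΦΨ] with q hq hq'
      rwa [hq'] at hq
    · have hline : Tendsto (fun y : ℂ => ((0 : ℂ), y)) (𝓝 x0.2) (𝓝 (0, x0.2)) :=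
        (Continuous.prodMk_right (0 : ℂ)).tendsto x0.2
      filter_upwards [hΦ₀, hline.eventually hΨΦ] with y hy hy'
      rw [← hy, hy']
  · intro ω₁ ω₂ h₁ hX₁' hf₁ h₂ hX₂' hf₂
    filter_upwards [hΦΨ, hcont.eventually (eventually_comp_flow_eq hΦ hΦ₀ hΦ' h₁ hX₁' hf₁),
      hcont.eventually (eventually_comp_flow_eq hΦ hΦ₀ hΦ' h₂ hX₂' hf₂)] with q hq hq₁ hq₂
    rw [hq] at hq₁ hq₂
    rw [hq₁, hq₂]
end

section
/- Suppose X₁(0,0) ≠ 0 and let ω ∈ Ω¹. Then a function u analytic in a neighborhood of (0,0) belongs to Ω¹ if and only if there exists f ∈ 𝒜₀¹ such that u(x₁,x₂) = f(ω(x₁,x₂)) for all (x₁,x₂) in a neighborhood of (0,0). -/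
open Filter MvPolynomial

theorem d1_eq_fderiv {g : ℂ × ℂ → ℂ} {p : ℂ × ℂ} (hg : DifferentiableAt ℂ g p) :
    d1 g p = fderiv ℂ g p (1, 0) := by
  have h : HasDerivAt (fun x : ℂ => (x, p.2)) ((1 : ℂ), (0 : ℂ)) p.1 :=
    (hasDerivAt_id p.1).prodMk (hasDerivAt_const p.1 p.2)
  exact (HasFDerivAt.comp_hasDerivAt (l := g) p.1 hg.hasFDerivAt h).deriv

theorem d2_eq_fderiv {g : ℂ × ℂ → ℂ} {p : ℂ × ℂ} (hg : DifferentiableAt ℂ g p) :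
    d2 g p = fderiv ℂ g p (0, 1) := by
  have h : HasDerivAt (fun y : ℂ => (p.1, y)) ((0 : ℂ), (1 : ℂ)) p.2 :=
    (hasDerivAt_const p.2 p.1).prodMk (hasDerivAt_id p.2)
  exact (HasFDerivAt.comp_hasDerivAt (l := g) p.2 hg.hasFDerivAt h).deriv

theorem fderiv_apply_eq_d1_d2 {g : ℂ × ℂ → ℂ} {p : ℂ × ℂ} (hg : DifferentiableAt ℂ g p)
    (a b : ℂ) : fderiv ℂ g p (a, b) = a * d1 g p + b * d2 g p := by
  have h : ((a, b) : ℂ × ℂ) = a • ((1 : ℂ), (0 : ℂ)) + b • ((0 : ℂ), (1 : ℂ)) := by simp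
  rw [d1_eq_fderiv hg, d2_eq_fderiv hg, h, map_add, map_smul, map_smul, smul_eq_mul, smul_eq_mul]

theorem fderiv_eq_smul_of_eventuallyEq_comp {u ω : ℂ × ℂ → ℂ} {f : ℂ → ℂ} {p : ℂ × ℂ}
    (hω : DifferentiableAt ℂ ω p) (hf : DifferentiableAt ℂ f (ω p))
    (h : ∀ᶠ q in nhds p, u q = f (ω q)) : fderiv ℂ u p = deriv f (ω p) • fderiv ℂ ω p := by
  have h1 : HasFDerivAt (f ∘ ω) (deriv f (ω p) • fderiv ℂ ω p) p :=
    hf.hasDerivAt.comp_hasFDerivAt p hω.hasFDerivAt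
  exact (h1.congr_of_eventuallyEq h).fderiv

theorem continuous_pev (P : MvPolynomial (Fin 2) ℂ) : Continuous (pev P) := by
  unfold pev
  refine (MvPolynomial.continuous_eval P).comp (continuous_pi fun i => ?_)
  fin_cases i
  · exact continuous_fst
  · exact continuous_snd

theorem not_eventually_const_of_d2_ne_zero {u : ℂ × ℂ → ℂ} {p : ℂ × ℂ} (h : d2 u p ≠ 0) :
    ¬ ∃ c : ℂ, ∀ᶠ q in nhds p, u q = c := by
  rintro ⟨c, hc⟩
  refine h ?_
  have ht : Tendsto (fun y : ℂ => (p.1, y)) (nhds p.2) (nhds p) :=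
    (Continuous.prodMk_right p.1).tendsto p.2
  have he : (fun y => u (p.1, y)) =ᶠ[nhds p.2] fun _ => c := ht.eventually hc
  simp [d2, he.deriv_eq]

/-- Straightening of a function `ω` with `∂₂ω ≠ 0`: the map `(x, y) ↦ (x, ω (x, y))` has an
analytic local inverse. -/
theorem exists_analytic_straightening {ω : ℂ × ℂ → ℂ} {p : ℂ × ℂ} (hω : AnalyticAt ℂ ω p)
    (h2 : d2 ω p ≠ 0) :
    ∃ Ψ : ℂ × ℂ → ℂ × ℂ, AnalyticAt ℂ Ψ (p.1, ω p) ∧ Ψ (p.1, ω p) = p ∧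
      (∀ᶠ q in nhds p, Ψ (q.1, ω q) = q) ∧
      ∀ᶠ q in nhds (p.1, ω p), ((Ψ q).1, ω (Ψ q)) = q := by
  have hd := hω.differentiableAt
  let e := (ContinuousLinearEquiv.refl ℂ ℂ).skewProd
    (ContinuousLinearEquiv.unitsEquivAut ℂ (Units.mk0 _ h2))
    ((fderiv ℂ ω p).comp (ContinuousLinearMap.inl ℂ ℂ ℂ))
  let Φ : ℂ × ℂ → ℂ × ℂ := fun q => (q.1, ω q)
  have hΦ : ContDiffAt ℂ ⊤ Φ p := contDiffAt_fst.prodMk hω.contDiffAt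
  have hΦ' : HasFDerivAt Φ (e : ℂ × ℂ →L[ℂ] ℂ × ℂ) p := by
    refine (hasFDerivAt_fst.prodMk hd.hasFDerivAt).congr_fderiv ?_
    refine ContinuousLinearMap.ext fun v => Prod.ext ?_ ?_
    · simp [e]
    · obtain ⟨a, b⟩ := v
      simp [e, fderiv_apply_eq_d1_d2 hd, add_comm]
  have hs := hΦ.hasStrictFDerivAt' hΦ' (by simp)
  exact ⟨hs.localInverse Φ e p, (hΦ.to_localInverse hΦ' (by simp)).analyticAt,
    hs.localInverse_apply_image, hs.eventually_left_inverse, hs.eventually_right_inverse⟩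

/-- Two functions annihilated by `X` are functionally dependent: the composition of one of them
with a local section straightening the other does not depend on the first variable. -/
theorem deriv_comp_straightening_eq_zero {X₁ X₂ : MvPolynomial (Fin 2) ℂ} {u ω : ℂ × ℂ → ℂ}
    {Ψ : ℂ × ℂ → ℂ × ℂ} {q : ℂ × ℂ} (hΨ : DifferentiableAt ℂ Ψ q)
    (hu : DifferentiableAt ℂ u (Ψ q)) (hω : DifferentiableAt ℂ ω (Ψ q))
    (hX : pev X₁ (Ψ q) ≠ 0) (hω2 : d2 ω (Ψ q) ≠ 0)
    (hXu : Xop X₁ X₂ u (Ψ q) = 0) (hXω : Xop X₁ X₂ ω (Ψ q) = 0)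
    (hr : ∀ᶠ z in nhds q, ((Ψ z).1, ω (Ψ z)) = z) :
    HasDerivAt (fun s => u (Ψ (s, q.2))) 0 q.1 := by
  have hline : HasDerivAt (fun s : ℂ => (s, q.2)) ((1 : ℂ), (0 : ℂ)) q.1 :=
    (hasDerivAt_id q.1).prodMk (hasDerivAt_const q.1 q.2)
  have hc : HasDerivAt (fun s => Ψ (s, q.2)) (fderiv ℂ Ψ q (1, 0)) q.1 :=
    HasFDerivAt.comp_hasDerivAt (l := Ψ) q.1 hΨ.hasFDerivAt hline
  generalize fderiv ℂ Ψ q (1, 0) = v at hc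
  obtain ⟨a, b⟩ := v
  have hline_tendsto : Tendsto (fun s : ℂ => (s, q.2)) (nhds q.1) (nhds q) :=
    (Continuous.prodMk_left q.2).tendsto q.1
  have hr' := hline_tendsto.eventually hr
  have hu' : HasDerivAt (fun s => u (Ψ (s, q.2))) (fderiv ℂ u (Ψ q) (a, b)) q.1 :=
    HasFDerivAt.comp_hasDerivAt (l := u) q.1 hu.hasFDerivAt hc
  have hω' : HasDerivAt (fun s => ω (Ψ (s, q.2))) (fderiv ℂ ω (Ψ q) (a, b)) q.1 :=
    HasFDerivAt.comp_hasDerivAt (l := ω) q.1 hω.hasFDerivAt hc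
  have ha : a = 1 := by
    have h1 : HasDerivAt (fun s => (Ψ (s, q.2)).1) a q.1 :=
      hasFDerivAt_fst.comp_hasDerivAt (f' := (a, b)) q.1 hc
    exact h1.unique ((hasDerivAt_id q.1).congr_of_eventuallyEq
      (hr'.mono fun s hs => congrArg Prod.fst hs))
  have hb : fderiv ℂ ω (Ψ q) (a, b) = 0 :=
    hω'.unique ((hasDerivAt_const q.1 q.2).congr_of_eventuallyEq
      (hr'.mono fun s hs => congrArg Prod.snd hs))
  convert hu' using 1
  rw [fderiv_apply_eq_d1_d2 hω, ha] at hb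
  rw [fderiv_apply_eq_d1_d2 hu, ha]
  simp only [Xop] at hXu hXω
  have : pev X₁ (Ψ q) * d2 ω (Ψ q) * (1 * d1 u (Ψ q) + b * d2 u (Ψ q)) = 0 := by
    linear_combination d2 ω (Ψ q) * hXu - d2 u (Ψ q) * hXω + pev X₁ (Ψ q) * d2 u (Ψ q) * hb
  exact ((mul_eq_zero.mp this).resolve_left (mul_ne_zero hX hω2)).symm

/-- A first integral factors locally through any first integral `ω` with `∂₂ω ≠ 0`. -/
theorem exists_analytic_factorization {X₁ X₂ : MvPolynomial (Fin 2) ℂ} {u ω : ℂ × ℂ → ℂ}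
    {p : ℂ × ℂ} (hX₁ : pev X₁ p ≠ 0) (hω : AnalyticAt ℂ ω p) (hω2 : d2 ω p ≠ 0)
    (hXω : ∀ᶠ q in nhds p, Xop X₁ X₂ ω q = 0) (hu : AnalyticAt ℂ u p)
    (hXu : ∀ᶠ q in nhds p, Xop X₁ X₂ u q = 0) :
    ∃ f : ℂ → ℂ, AnalyticAt ℂ f (ω p) ∧ ∀ᶠ q in nhds p, u q = f (ω q) := by
  obtain ⟨Ψ, hΨ, hΨp, hl, hr⟩ := exists_analytic_straightening hω hω2
  have hd2 : ∀ᶠ q in nhds p, d2 ω q ≠ 0 := by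
    have hc : ContinuousAt (fun q => fderiv ℂ ω q (0, 1)) p :=
      hω.fderiv.continuousAt.clm_apply continuousAt_const
    rw [d2_eq_fderiv hω.differentiableAt] at hω2
    filter_upwards [hc.eventually_ne hω2, hω.eventually_analyticAt] with q h1 h2
    rwa [d2_eq_fderiv h2.differentiableAt]
  have hΨt : Tendsto Ψ (nhds (p.1, ω p)) (nhds p) := by
    simpa only [hΨp] using hΨ.continuousAt.tendsto
  have hgood := hΨt.eventually (((continuous_pev X₁).continuousAt.eventually_ne hX₁).and
    (hd2.and (hXω.and (hXu.and (hω.eventually_analyticAt.and hu.eventually_analyticAt)))))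
  have hderiv : ∀ᶠ q in nhds (p.1, ω p), HasDerivAt (fun s => u (Ψ (s, q.2))) 0 q.1 := by
    filter_upwards [hgood, hΨ.eventually_analyticAt, hr.eventually_nhds] with q hq hΨq hrq
    obtain ⟨h1, h2, h3, h4, h5, h6⟩ := hq
    exact deriv_comp_straightening_eq_zero hΨq.differentiableAt h6.differentiableAt
      h5.differentiableAt h1 h2 h4 h3 hrq
  obtain ⟨r, hr0, hball⟩ := Metric.eventually_nhds_iff_ball.mp hderiv
  refine ⟨fun t => u (Ψ (p.1, t)), ?_, ?_⟩
  · have hline : AnalyticAt ℂ (fun t : ℂ => (p.1, t)) (ω p) := analyticAt_const.prod analyticAt_id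
    have hΨl : AnalyticAt ℂ (fun t => Ψ (p.1, t)) (ω p) :=
      AnalyticAt.fun_comp (g := Ψ) hΨ hline
    exact AnalyticAt.fun_comp (g := u) (by simpa only [hΨp] using hu) hΨl
  · have hΦ : ContinuousAt (fun q : ℂ × ℂ => (q.1, ω q)) p :=
      continuousAt_fst.prodMk hω.continuousAt
    filter_upwards [hl, hΦ.eventually (Metric.ball_mem_nhds _ hr0)] with q hq hqb
    rw [← Metric.mem_ball, ← ball_prod_same] at hqb
    rw [← ball_prod_same] at hball
    have hD : ∀ s ∈ Metric.ball p.1 r, HasDerivAt (fun s => u (Ψ (s, ω q))) 0 s :=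
      fun s hs => hball (s, ω q) ⟨hs, hqb.2⟩
    have := Metric.isOpen_ball.is_const_of_deriv_eq_zero
      (convex_ball p.1 r).isPreconnected
      (fun s hs => (hD s hs).differentiableAt.differentiableWithinAt)
      (fun s hs => (hD s hs).deriv) hqb.1 (Metric.mem_ball_self hr0)
    simpa only [hq] using this

/-- for `ω ∈ Ω¹`, an analytic `u` belongs to `Ω¹` iff `u = f ∘ ω` near `(0,0)`
for some `f ∈ 𝒜₀¹`. -/
theorem stmt_2 (X₁ X₂ : MvPolynomial (Fin 2) ℂ)
    (hX₁ : pev X₁ ((0 : ℂ), (0 : ℂ)) ≠ 0) (ω : ℂ × ℂ → ℂ)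
    (hω : IsFirstIntegralAt X₁ X₂ ω ((0 : ℂ), (0 : ℂ)))
    (hω0 : ω ((0 : ℂ), (0 : ℂ)) = 0) (hω2 : d2 ω ((0 : ℂ), (0 : ℂ)) ≠ 0)
    (u : ℂ × ℂ → ℂ) (hu : AnalyticAt ℂ u ((0 : ℂ), (0 : ℂ))) :
    (IsFirstIntegralAt X₁ X₂ u ((0 : ℂ), (0 : ℂ)) ∧
        u ((0 : ℂ), (0 : ℂ)) = 0 ∧ d2 u ((0 : ℂ), (0 : ℂ)) ≠ 0) ↔
      ∃ f : ℂ → ℂ, AnalyticAt ℂ f 0 ∧ f 0 = 0 ∧ deriv f 0 ≠ 0 ∧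
        ∀ᶠ q in nhds ((0 : ℂ), (0 : ℂ)), u q = f (ω q) := by
  have hd0 := hω.1.differentiableAt
  constructor
  · rintro ⟨⟨-, hXu, -⟩, hu0, hu2⟩
    obtain ⟨f, hf, hfu⟩ := exists_analytic_factorization hX₁ hω.1 hω2 hω.2.1 hu hXu
    refine ⟨f, hω0 ▸ hf, ?_, fun h0 => hu2 ?_, hfu⟩
    · rw [← hω0, ← hfu.self_of_nhds, hu0, hω0]
    · rw [d2_eq_fderiv hu.differentiableAt,
        fderiv_eq_smul_of_eventuallyEq_comp hd0 hf.differentiableAt hfu, hω0, h0]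
      simp
  · rintro ⟨f, hf, hf0, hf1, hfu⟩
    have hu2 : d2 u ((0 : ℂ), (0 : ℂ)) ≠ 0 := by
      rw [d2_eq_fderiv hu.differentiableAt, fderiv_eq_smul_of_eventuallyEq_comp hd0
        (by rw [hω0]; exact hf.differentiableAt) hfu, hω0]
      rw [d2_eq_fderiv hd0] at hω2
      exact mul_ne_zero hf1 hω2
    refine ⟨⟨hu, ?_, not_eventually_const_of_d2_ne_zero hu2⟩, ?_, hu2⟩
    · have hfω : ∀ᶠ q in nhds ((0 : ℂ), (0 : ℂ)), AnalyticAt ℂ f (ω q) :=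
        hω.1.continuousAt.eventually (by rw [hω0]; exact hf.eventually_analyticAt)
      filter_upwards [hω.1.eventually_analyticAt, hω.2.1, hfω, hfu.eventually_nhds,
        hu.eventually_analyticAt] with q hωq hXq hfq hfuq huq
      have hfd := fderiv_eq_smul_of_eventuallyEq_comp hωq.differentiableAt hfq.differentiableAt hfuq
      simp only [Xop, d1_eq_fderiv hωq.differentiableAt, d2_eq_fderiv hωq.differentiableAt] at hXq
      simp only [Xop, d1_eq_fderiv huq.differentiableAt, d2_eq_fderiv huq.differentiableAt, hfd,
        smul_apply, smul_eq_mul]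
      linear_combination deriv f (ω q) * hXq
    · rw [hfu.self_of_nhds, hω0, hf0]
end

section
/- Suppose X₁(0,0) ≠ 0, let ω ∈ Ω¹, let n ≥ 1 be an integer, and let a be a rational function in x₁,x₂ that is defined (pole-free) in a neighborhood of (0,0). Let f be a function of one complex variable analytic at 0. If (∂₂ω)ⁿ = a and (∂₂(f∘ω))ⁿ = a hold in a neighborhood of (0,0), then there exist complex constants μ, c with μⁿ = 1 such that f(z) = μ·z + c for all z in a neighborhood of 0. -/
open Filter MvPolynomial

open Topology in
/-- A function analytic at `z₀` whose derivative is an `n`-th root of unity near `z₀` is affine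
near `z₀`, with slope an `n`-th root of unity. -/
theorem AnalyticAt.eventually_eq_affine_of_deriv_pow_eq_one {f : ℂ → ℂ} {z₀ : ℂ} {n : ℕ}
    (hn : n ≠ 0) (hf : AnalyticAt ℂ f z₀) (h : ∀ᶠ z in 𝓝 z₀, deriv f z ^ n = 1) :
    ∃ μ c : ℂ, μ ^ n = 1 ∧ ∀ᶠ z in 𝓝 z₀, f z = μ * z + c := by
  have hfin : {w : ℂ | w ^ n = 1}.Finite := by
    have : {w : ℂ | w ^ n = 1} ⊆ ↑(Polynomial.nthRoots n (1 : ℂ)).toFinset := by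
      intro w hw
      simpa [Polynomial.mem_nthRoots (Nat.pos_of_ne_zero hn)] using hw
    exact (Finset.finite_toSet _).subset this
  have hconst : ∀ᶠ z in 𝓝 z₀, deriv f z = deriv f z₀ := by
    have hnhds : ({w : ℂ | w ^ n = 1} \ {deriv f z₀})ᶜ ∈ 𝓝 (deriv f z₀) :=
      (hfin.subset Set.sdiff_subset).isClosed.isOpen_compl.mem_nhds (by simp)
    filter_upwards [h, hf.deriv.continuousAt.preimage_mem_nhds hnhds] with z hz hz'
    by_contra hne
    exact hz' ⟨hz, hne⟩
  obtain ⟨r, hr, hball⟩ := Metric.eventually_nhds_iff_ball.1 (hconst.and hf.eventually_analyticAt)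
  refine ⟨deriv f z₀, f z₀ - deriv f z₀ * z₀, h.self_of_nhds, ?_⟩
  have hderiv : ∀ z ∈ Metric.ball z₀ r, HasDerivAt (fun z => f z - deriv f z₀ * z) 0 z := by
    intro z hz
    have h' := (hball z hz).2.differentiableAt.hasDerivAt.fun_sub
      ((hasDerivAt_id' z).const_mul (deriv f z₀))
    rwa [(hball z hz).1, mul_one, sub_self] at h'
  filter_upwards [Metric.ball_mem_nhds z₀ hr] with z hz
  have heq : f z - deriv f z₀ * z = f z₀ - deriv f z₀ * z₀ :=
    Metric.isOpen_ball.is_const_of_deriv_eq_zero (convex_ball z₀ r).isPreconnected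
      (fun w hw => (hderiv w hw).differentiableAt.differentiableWithinAt)
      (fun w hw => (hderiv w hw).deriv) hz (Metric.mem_ball_self hr)
  linear_combination heq

open Topology in
/-- If `g` is analytic with nonzero derivative at `y₀` and `g'` and `(f ∘ g)'` have the same
`n`-th power near `y₀`, then `f'` is an `n`-th root of unity near `g y₀`. -/
theorem eventually_deriv_pow_eq_one_of_deriv_comp_pow_eq {f g : ℂ → ℂ} {y₀ : ℂ} {n : ℕ}
    (hg : AnalyticAt ℂ g y₀) (hg' : deriv g y₀ ≠ 0) (hf : AnalyticAt ℂ f (g y₀))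
    (h : ∀ᶠ y in 𝓝 y₀, deriv (fun y => f (g y)) y ^ n = deriv g y ^ n) :
    ∀ᶠ z in 𝓝 (g y₀), deriv f z ^ n = 1 := by
  rw [← hg.hasStrictDerivAt.map_nhds_eq hg', eventually_map]
  filter_upwards [h, hg.eventually_analyticAt, hg.deriv.continuousAt.eventually_ne hg',
    hg.continuousAt.eventually hf.eventually_analyticAt] with y hy hgy hne hfy
  have hc : deriv (fun y => f (g y)) y = deriv f (g y) * deriv g y :=
    (hfy.differentiableAt.hasDerivAt.comp y hgy.differentiableAt.hasDerivAt).deriv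
  rw [hc, mul_pow] at hy
  exact mul_right_cancel₀ (pow_ne_zero n hne) (by rw [hy, one_mul])

/-- if `(∂₂ω)ⁿ` and `(∂₂(f∘ω))ⁿ` both equal the same pole-free rational
function `P/Q` near `(0,0)`, then `f(z) = μ·z + c` with `μⁿ = 1`. -/
theorem stmt_5 (X₁ X₂ : MvPolynomial (Fin 2) ℂ)
    (hX₁ : pev X₁ ((0 : ℂ), (0 : ℂ)) ≠ 0) (ω : ℂ × ℂ → ℂ)
    (hω : IsFirstIntegralAt X₁ X₂ ω ((0 : ℂ), (0 : ℂ)))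
    (hω0 : ω ((0 : ℂ), (0 : ℂ)) = 0) (hω2 : d2 ω ((0 : ℂ), (0 : ℂ)) ≠ 0)
    (n : ℕ) (hn : 1 ≤ n)
    (P Q : MvPolynomial (Fin 2) ℂ) (hQ : pev Q ((0 : ℂ), (0 : ℂ)) ≠ 0)
    (f : ℂ → ℂ) (hf : AnalyticAt ℂ f 0)
    (h1 : ∀ᶠ q in nhds ((0 : ℂ), (0 : ℂ)), d2 ω q ^ n = pev P q / pev Q q)
    (h2 : ∀ᶠ q in nhds ((0 : ℂ), (0 : ℂ)),
      d2 (fun p => f (ω p)) q ^ n = pev P q / pev Q q) :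
    ∃ μ c : ℂ, μ ^ n = 1 ∧ ∀ᶠ z in nhds (0 : ℂ), f z = μ * z + c := by
  have hg : AnalyticAt ℂ (fun y : ℂ => ω (0, y)) 0 :=
    hω.1.comp_of_eq (analyticAt_const.prod analyticAt_id) rfl
  have hslice : Tendsto (fun y : ℂ => ((0 : ℂ), y)) (nhds 0) (nhds (0, 0)) :=
    (Continuous.prodMk_right (0 : ℂ)).tendsto 0
  have h : ∀ᶠ z in nhds (ω (0, 0)), deriv f z ^ n = 1 := by
    refine eventually_deriv_pow_eq_one_of_deriv_comp_pow_eq (g := fun y : ℂ => ω (0, y)) hg hω2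
      (by simpa only [hω0] using hf) ?_
    filter_upwards [hslice.eventually h1, hslice.eventually h2] with y hy1 hy2
    exact hy2.trans hy1.symm
  rw [hω0] at h
  exact hf.eventually_eq_affine_of_deriv_pow_eq_one (Nat.one_le_iff_ne_zero.1 hn) h
end

section
/- Suppose X₁(0,0) ≠ 0, let ω ∈ Ω¹, and let a be a rational function in x₁,x₂ defined (pole-free) in a neighborhood of (0,0). Let f be a function of one complex variable analytic at 0 with f'(0) ≠ 0. If ∂₂²ω = a·∂₂ω and ∂₂²(f∘ω) = a·∂₂(f∘ω) hold in a neighborhood of (0,0), then f'' ≡ 0 near 0, i.e., f(z) = f(0) + f'(0)·z for all z in a neighborhood of 0. -/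
open Filter MvPolynomial

/-- An analytic function whose derivative vanishes near a point is constant near that point. -/
theorem AnalyticAt.eventually_eq_of_deriv_eq_zero {g : ℂ → ℂ} {z₀ : ℂ} (hg : AnalyticAt ℂ g z₀)
    (h : ∀ᶠ z in nhds z₀, deriv g z = 0) : ∀ᶠ z in nhds z₀, g z = g z₀ := by
  obtain ⟨r, hr, hball⟩ := Metric.eventually_nhds_iff_ball.1 (hg.eventually_analyticAt.and h)
  filter_upwards [Metric.ball_mem_nhds z₀ hr] with z hz
  exact Metric.isOpen_ball.is_const_of_deriv_eq_zero (convex_ball z₀ r).isPreconnected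
    (fun w hw => (hball w hw).1.differentiableAt.differentiableWithinAt)
    (fun w hw => (hball w hw).2) hz (Metric.mem_ball_self hr)

/-- An analytic function whose second derivative vanishes near `0` is affine near `0`. -/
theorem AnalyticAt.eventually_eq_affine {f : ℂ → ℂ} (hf : AnalyticAt ℂ f 0)
    (h : ∀ᶠ z in nhds (0 : ℂ), deriv (deriv f) z = 0) :
    ∀ᶠ z in nhds (0 : ℂ), f z = f 0 + deriv f 0 * z := by
  have hlin : AnalyticAt ℂ (fun z : ℂ => f z - deriv f 0 * z) 0 :=
    hf.sub (analyticAt_const.mul analyticAt_id)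
  have hconst := hlin.eventually_eq_of_deriv_eq_zero (by
    filter_upwards [hf.eventually_analyticAt, hf.deriv.eventually_eq_of_deriv_eq_zero h]
      with z hz hd
    have := hz.differentiableAt.hasDerivAt.sub ((hasDerivAt_id z).const_mul (deriv f 0))
    refine this.deriv.trans ?_
    rw [hd]
    ring)
  filter_upwards [hconst] with z hz
  linear_combination hz

/-- The second derivative of a composition of analytic functions. -/
theorem AnalyticAt.eventually_deriv_deriv_comp {f u : ℂ → ℂ} {y₀ : ℂ}
    (hf : AnalyticAt ℂ f (u y₀)) (hu : AnalyticAt ℂ u y₀) :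
    ∀ᶠ y in nhds y₀, deriv (fun t => f (u t)) y = deriv f (u y) * deriv u y ∧
      deriv (deriv (fun t => f (u t))) y =
        deriv (deriv f) (u y) * deriv u y ^ 2 + deriv f (u y) * deriv (deriv u) y := by
  have hfu := hu.continuousAt.eventually hf.eventually_analyticAt
  have hfirst : ∀ᶠ y in nhds y₀, deriv (fun t => f (u t)) y = deriv f (u y) * deriv u y := by
    filter_upwards [hfu, hu.eventually_analyticAt] with y hfy huy
    exact (hfy.differentiableAt.hasDerivAt.comp y huy.differentiableAt.hasDerivAt).deriv
  filter_upwards [hfirst.eventually_nhds, hfu, hu.eventually_analyticAt] with y hy hfy huy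
  refine ⟨hy.self_of_nhds, ?_⟩
  rw [Filter.EventuallyEq.deriv_eq hy]
  have := (hfy.deriv.differentiableAt.hasDerivAt.comp y huy.differentiableAt.hasDerivAt).mul
    huy.deriv.differentiableAt.hasDerivAt
  refine this.deriv.trans ?_
  simp only [Function.comp_apply]
  ring

/-- If `u` and `f ∘ u` solve the same equation `v'' = a v'`, where `u 0 = 0` and `u' 0 ≠ 0`,
then `f` is affine near `0`. -/
theorem eventually_eq_affine_of_comp {f u a : ℂ → ℂ} (hf : AnalyticAt ℂ f 0)
    (hu : AnalyticAt ℂ u 0) (hu0 : u 0 = 0) (hu' : deriv u 0 ≠ 0)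
    (h1 : ∀ᶠ y in nhds (0 : ℂ), deriv (deriv u) y = a y * deriv u y)
    (h2 : ∀ᶠ y in nhds (0 : ℂ),
      deriv (deriv (fun t => f (u t))) y = a y * deriv (fun t => f (u t)) y) :
    ∀ᶠ z in nhds (0 : ℂ), f z = f 0 + deriv f 0 * z := by
  refine hf.eventually_eq_affine ?_
  have hmap := hu.hasStrictDerivAt.map_nhds_eq hu'
  rw [hu0] at hmap
  rw [← hmap, Filter.eventually_map]
  filter_upwards [h1, h2, AnalyticAt.eventually_deriv_deriv_comp (hu0.symm ▸ hf) hu,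
    hu.deriv.continuousAt.eventually_ne hu'] with y hy1 hy2 hy hne
  rw [hy.1, hy.2, hy1] at hy2
  have : deriv (deriv f) (u y) * deriv u y ^ 2 = 0 := by linear_combination hy2
  exact (mul_eq_zero.1 this).resolve_right (pow_ne_zero 2 hne)

/-- if `∂₂²ω = a·∂₂ω` and `∂₂²(f∘ω) = a·∂₂(f∘ω)` for the same pole-free
rational function `a = P/Q`, then `f` is affine near `0`: `f(z) = f(0) + f'(0)·z`. -/
theorem stmt_6 (X₁ X₂ : MvPolynomial (Fin 2) ℂ)
    (hX₁ : pev X₁ ((0 : ℂ), (0 : ℂ)) ≠ 0) (ω : ℂ × ℂ → ℂ)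
    (hω : IsFirstIntegralAt X₁ X₂ ω ((0 : ℂ), (0 : ℂ)))
    (hω0 : ω ((0 : ℂ), (0 : ℂ)) = 0) (hω2 : d2 ω ((0 : ℂ), (0 : ℂ)) ≠ 0)
    (P Q : MvPolynomial (Fin 2) ℂ) (hQ : pev Q ((0 : ℂ), (0 : ℂ)) ≠ 0)
    (f : ℂ → ℂ) (hf : AnalyticAt ℂ f 0) (hf' : deriv f 0 ≠ 0)
    (h1 : ∀ᶠ q in nhds ((0 : ℂ), (0 : ℂ)),
      d2^[2] ω q = (pev P q / pev Q q) * d2 ω q)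
    (h2 : ∀ᶠ q in nhds ((0 : ℂ), (0 : ℂ)),
      d2^[2] (fun p => f (ω p)) q = (pev P q / pev Q q) * d2 (fun p => f (ω p)) q) :
    ∀ᶠ z in nhds (0 : ℂ), f z = f 0 + deriv f 0 * z := by
  have hline : AnalyticAt ℂ (fun y : ℂ => ((0 : ℂ), y)) 0 := analyticAt_const.prod analyticAt_id
  have hu : AnalyticAt ℂ (fun y : ℂ => ω (0, y)) 0 := hω.1.comp hline
  exact eventually_eq_affine_of_comp (a := fun y => pev P (0, y) / pev Q (0, y)) hf hu hω0 hω2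
    (hline.continuousAt.eventually h1) (hline.continuousAt.eventually h2)
end

section
/- Suppose X₁(0,0) ≠ 0, let ω ∈ Ω¹, and let a be a rational function in x₁,x₂ defined (pole-free) in a neighborhood of (0,0). Let f be a function of one complex variable analytic at 0 with f'(0) ≠ 0. If 2·∂₂ω·∂₂³ω − 3·(∂₂²ω)² = a·(∂₂ω)² and 2·∂₂(f∘ω)·∂₂³(f∘ω) − 3·(∂₂²(f∘ω))² = a·(∂₂(f∘ω))² hold in a neighborhood of (0,0), then 2·f'·f''' − 3·(f'')² ≡ 0 near 0; equivalently, there exist complex constants α, β, c with α ≠ 0 such that f(z) = α·z/(1 + β·z) + c for all z in a neighborhood of 0. -/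
open Filter MvPolynomial

/-- A function whose derivative vanishes near `a` is locally constant at `a`. -/
theorem eventually_eq_of_eventually_hasDerivAt_zero {u : ℂ → ℂ} {a : ℂ}
    (h : ∀ᶠ z in nhds a, HasDerivAt u 0 z) : ∀ᶠ z in nhds a, u z = u a := by
  obtain ⟨r, hr, hball⟩ := Metric.eventually_nhds_iff_ball.1 h
  filter_upwards [Metric.ball_mem_nhds a hr] with z hz
  exact Metric.isOpen_ball.is_const_of_deriv_eq_zero (convex_ball a r).isPreconnected
    (fun x hx => (hball x hx).differentiableAt.differentiableWithinAt)
    (fun x hx => (hball x hx).deriv) hz (Metric.mem_ball_self hr)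

/-- The numerator of (twice) the Schwarzian derivative of a function of one complex variable. -/
noncomputable def polySchwarzian (u : ℂ → ℂ) (z : ℂ) : ℂ :=
  2 * deriv u z * deriv (deriv (deriv u)) z - 3 * (deriv (deriv u) z) ^ 2

theorem deriv_comp_eventuallyEq {f w : ℂ → ℂ} {y : ℂ} (hw : AnalyticAt ℂ w y)
    (hf : AnalyticAt ℂ f (w y)) :
    deriv (fun t => f (w t)) =ᶠ[nhds y] fun t => deriv f (w t) * deriv w t := by
  filter_upwards [hw.eventually_analyticAt,
    hw.continuousAt.eventually hf.eventually_analyticAt] with t ht hft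
  exact (hft.differentiableAt.hasDerivAt.comp t ht.differentiableAt.hasDerivAt).deriv

/-- The chain rule for the polynomial Schwarzian. -/
theorem polySchwarzian_comp {f w : ℂ → ℂ} {y : ℂ} (hw : AnalyticAt ℂ w y)
    (hf : AnalyticAt ℂ f (w y)) :
    polySchwarzian (fun t => f (w t)) y =
      polySchwarzian f (w y) * deriv w y ^ 4 + deriv f (w y) ^ 2 * polySchwarzian w y := by
  have e1 := deriv_comp_eventuallyEq hw hf
  have e2 : deriv (deriv (fun t => f (w t))) =ᶠ[nhds y]
      fun t => deriv (deriv f) (w t) * deriv w t ^ 2 + deriv f (w t) * deriv (deriv w) t := by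
    filter_upwards [e1.deriv, hw.eventually_analyticAt,
      hw.continuousAt.eventually hf.eventually_analyticAt] with t h ht hft
    rw [h]
    have a1 := hft.deriv.differentiableAt.hasDerivAt.comp t ht.differentiableAt.hasDerivAt
    refine ((a1.mul ht.deriv.differentiableAt.hasDerivAt).congr_deriv ?_).deriv
    simp only [Function.comp_apply]
    ring
  have e3 : deriv (deriv (deriv (fun t => f (w t)))) y =
      deriv (deriv (deriv f)) (w y) * deriv w y ^ 3
        + 3 * deriv (deriv f) (w y) * deriv w y * deriv (deriv w) y
        + deriv f (w y) * deriv (deriv (deriv w)) y := by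
    rw [e2.deriv_eq]
    have a1 := hf.deriv.differentiableAt.hasDerivAt.comp y hw.differentiableAt.hasDerivAt
    have a2 := hf.deriv.deriv.differentiableAt.hasDerivAt.comp y hw.differentiableAt.hasDerivAt
    have b1 := hw.deriv.differentiableAt.hasDerivAt
    have b2 := hw.deriv.deriv.differentiableAt.hasDerivAt
    refine (((a2.mul (b1.pow 2)).add (a1.mul b2)).congr_deriv ?_).deriv
    simp only [Function.comp_apply, Pi.pow_apply]
    push_cast
    ring
  simp only [polySchwarzian]
  rw [e1.self_of_nhds, e2.self_of_nhds, e3]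
  ring

/-- A locally injective function with vanishing Schwarzian near `0` is a Möbius map. -/
theorem exists_mobius_of_polySchwarzian_eq_zero {f : ℂ → ℂ} (hf : AnalyticAt ℂ f 0)
    (hf' : deriv f 0 ≠ 0) (h : ∀ᶠ z in nhds (0 : ℂ), polySchwarzian f z = 0) :
    ∃ α β c : ℂ, α ≠ 0 ∧ ∀ᶠ z in nhds (0 : ℂ), f z = α * z / (1 + β * z) + c := by
  obtain ⟨β, hβ⟩ : ∃ β : ℂ, deriv (deriv f) 0 + 2 * β * deriv f 0 = 0 :=
    ⟨-deriv (deriv f) 0 / (2 * deriv f 0), by field_simp; ring⟩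
  have hlin (z : ℂ) : HasDerivAt (fun z => 1 + β * z) β z := by
    simpa using ((hasDerivAt_id z).const_mul β).const_add 1
  have hne : ∀ᶠ z in nhds (0 : ℂ), 1 + β * z ≠ 0 :=
    (hlin 0).continuousAt.eventually_ne (by simp)
  have hne' : ∀ᶠ z in nhds (0 : ℂ), deriv f z ≠ 0 := hf.deriv.continuousAt.eventually_ne hf'
  set N : ℂ → ℂ := fun z => deriv (deriv f) z * (1 + β * z) + 2 * β * deriv f z with hN
  have hN0 : N 0 = 0 := by simpa [hN] using hβ
  have hNz : ∀ᶠ z in nhds (0 : ℂ), N z = 0 := by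
    have key : ∀ᶠ z in nhds (0 : ℂ), HasDerivAt (fun z => N z ^ 2 / deriv f z ^ 3) 0 z := by
      filter_upwards [hf.eventually_analyticAt, hne', h] with z hz hz' hS
      have b1 := hz.deriv.differentiableAt.hasDerivAt
      have b2 := hz.deriv.deriv.differentiableAt.hasDerivAt
      have dN : HasDerivAt N _ z := (b2.mul (hlin z)).add (b1.const_mul (2 * β))
      refine ((dN.pow 2).div (b1.pow 3) (pow_ne_zero 3 hz')).congr_deriv ?_
      rw [div_eq_zero_iff]
      left
      simp only [polySchwarzian] at hS
      simp only [hN, Pi.pow_apply]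
      push_cast
      linear_combination (deriv (deriv f) z * (1 + β * z) + 2 * β * deriv f z) *
        deriv f z ^ 2 * (1 + β * z) * hS
    filter_upwards [eventually_eq_of_eventually_hasDerivAt_zero key, hne'] with z hz hz'
    simpa [hN0, hz'] using hz
  have hf1 : ∀ᶠ z in nhds (0 : ℂ), deriv f z * (1 + β * z) ^ 2 = deriv f 0 := by
    have key : ∀ᶠ z in nhds (0 : ℂ), HasDerivAt (fun z => deriv f z * (1 + β * z) ^ 2) 0 z := by
      filter_upwards [hf.eventually_analyticAt, hNz] with z hz hzN
      refine (hz.deriv.differentiableAt.hasDerivAt.mul ((hlin z).pow 2)).congr_deriv ?_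
      simp only [hN] at hzN
      simp only [Pi.pow_apply]
      push_cast
      linear_combination (1 + β * z) * hzN
    simpa using eventually_eq_of_eventually_hasDerivAt_zero key
  refine ⟨deriv f 0, β, f 0, hf', ?_⟩
  have key : ∀ᶠ z in nhds (0 : ℂ),
      HasDerivAt (fun z => f z - deriv f 0 * z / (1 + β * z)) 0 z := by
    filter_upwards [hf.eventually_analyticAt, hf1, hne] with z hz h1 hz'
    have b := ((hasDerivAt_id z).const_mul (deriv f 0)).div (hlin z) hz'
    refine (hz.differentiableAt.hasDerivAt.sub b).congr_deriv ?_
    simp only [id]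
    rw [sub_eq_zero, eq_div_iff (pow_ne_zero 2 hz')]
    linear_combination h1
  filter_upwards [eventually_eq_of_eventually_hasDerivAt_zero key] with z hz
  simp only [mul_zero, zero_div, sub_zero] at hz
  linear_combination hz

/-- if the Schwarzian-type expressions of `ω` and `f∘ω` in `x₂` both equal
`a·(∂₂·)²` for the same pole-free rational `a = P/Q`, then `2f'f''' − 3(f'')² ≡ 0` near `0`;
equivalently `f` is a Möbius map `f(z) = α·z/(1 + β·z) + c` with `α ≠ 0`. -/
theorem stmt_7 (X₁ X₂ : MvPolynomial (Fin 2) ℂ)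
    (hX₁ : pev X₁ ((0 : ℂ), (0 : ℂ)) ≠ 0) (ω : ℂ × ℂ → ℂ)
    (hω : IsFirstIntegralAt X₁ X₂ ω ((0 : ℂ), (0 : ℂ)))
    (hω0 : ω ((0 : ℂ), (0 : ℂ)) = 0) (hω2 : d2 ω ((0 : ℂ), (0 : ℂ)) ≠ 0)
    (P Q : MvPolynomial (Fin 2) ℂ) (hQ : pev Q ((0 : ℂ), (0 : ℂ)) ≠ 0)
    (f : ℂ → ℂ) (hf : AnalyticAt ℂ f 0) (hf' : deriv f 0 ≠ 0)
    (h1 : ∀ᶠ q in nhds ((0 : ℂ), (0 : ℂ)),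
      2 * d2 ω q * d2^[3] ω q - 3 * (d2^[2] ω q) ^ 2
        = (pev P q / pev Q q) * (d2 ω q) ^ 2)
    (h2 : ∀ᶠ q in nhds ((0 : ℂ), (0 : ℂ)),
      2 * d2 (fun p => f (ω p)) q * d2^[3] (fun p => f (ω p)) q
          - 3 * (d2^[2] (fun p => f (ω p)) q) ^ 2
        = (pev P q / pev Q q) * (d2 (fun p => f (ω p)) q) ^ 2) :
    (∀ᶠ z in nhds (0 : ℂ),
        2 * deriv f z * iteratedDeriv 3 f z - 3 * (iteratedDeriv 2 f z) ^ 2 = 0) ∧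
      ∃ α β c : ℂ, α ≠ 0 ∧
        ∀ᶠ z in nhds (0 : ℂ), f z = α * z / (1 + β * z) + c := by
  have hwan : AnalyticAt ℂ (fun y => ω ((0 : ℂ), y)) 0 :=
    AnalyticAt.fun_comp (f := fun y : ℂ => ((0 : ℂ), y)) hω.1 (analyticAt_const.prod analyticAt_id)
  set w : ℂ → ℂ := fun y => ω ((0 : ℂ), y)
  have hw' : deriv w 0 ≠ 0 := hω2
  have hw0 : w 0 = 0 := hω0
  have hfw : AnalyticAt ℂ f (w 0) := by rwa [hw0]
  have hc : Tendsto (fun y : ℂ => ((0 : ℂ), y)) (nhds 0) (nhds ((0 : ℂ), (0 : ℂ))) :=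
    Continuous.tendsto (by fun_prop) 0
  have hSw : ∀ᶠ y in nhds (0 : ℂ), polySchwarzian f (w y) = 0 := by
    filter_upwards [hc.eventually h1, hc.eventually h2, hwan.eventually_analyticAt,
      hwan.continuousAt.eventually hfw.eventually_analyticAt,
      hwan.deriv.continuousAt.eventually_ne hw'] with y e1 e2 hy hfy hy'
    change polySchwarzian w y = _ * deriv w y ^ 2 at e1
    change polySchwarzian (fun t => f (w t)) y = _ * deriv (fun t => f (w t)) y ^ 2 at e2
    rw [polySchwarzian_comp hy hfy, (deriv_comp_eventuallyEq hy hfy).self_of_nhds, e1] at e2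
    have : polySchwarzian f (w y) * deriv w y ^ 4 = 0 := by linear_combination e2
    simpa [hy'] using this
  have hS : ∀ᶠ z in nhds (0 : ℂ), polySchwarzian f z = 0 := by
    have hmap : map w (nhds 0) = nhds 0 := by
      rw [hwan.hasStrictDerivAt.map_nhds_eq hw', hw0]
    rw [← hmap]
    exact hSw
  refine ⟨?_, exists_mobius_of_polySchwarzian_eq_zero hf hf' hS⟩
  simpa only [polySchwarzian, iteratedDeriv_succ, iteratedDeriv_zero] using hS
end
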